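/- Let f : S¹ → S¹ be a homeomorphism of the unit circle with f(1) = 1, and let conj : ℂ → ℂ denote complex conjugation z ↦ z̄. Then the radial mollified extensions satisfy F(f ∘ conj) = F(f) ∘ conj on the closed unit disc; equivalently, since conjugation and inversion agree on S¹, F(f ∘ (z ↦ 1/z)) = F(f) ∘ conj. -/

import Mathlib

open Metric MeasureTheory

noncomputable section

/-- The closed unit disc in `ℂ`. -/
def unitDisc : Set ℂ := Metric.closedBall 0 1

/-- The unit circle in `ℂ`. -/
def unitCircle : Set ℂ := Metric.sphere 0 1

/-- The normalization constant `c = ∫_{-1}^{1} exp(-1/(1-x²)) dx`. -/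
def bumpC : ℝ := ∫ x in (-1 : ℝ)..1, Real.exp (-1 / (1 - x ^ 2))

/-- The normalized smooth bump `β_ε` supported on `[-ε, ε]`. -/
def bump (ε x : ℝ) : ℝ :=
  if |x| < ε then (1 / (bumpC * ε)) * Real.exp (-1 / (1 - (x / ε) ^ 2)) else 0

/-- The convolution `(β_ε * g)(θ) = ∫ β_ε(x) g(θ - x) dx`. -/
def bumpConv (ε : ℝ) (g : ℝ → ℝ) (θ : ℝ) : ℝ := ∫ x : ℝ, bump ε x * g (θ - x)

/-- `f` restricts to a homeomorphism of the unit circle (a continuous bijection of the compact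
circle onto itself). -/
def CircleHomeo (f : ℂ → ℂ) : Prop :=
  ContinuousOn f unitCircle ∧ Set.BijOn f unitCircle unitCircle

/-- `g` is the continuous lift of `f` with `f (e^{iθ}) = e^{i g θ}` and `g 0 = 0`. -/
def IsLift (f : ℂ → ℂ) (g : ℝ → ℝ) : Prop :=
  Continuous g ∧ g 0 = 0 ∧
    ∀ θ : ℝ, f (Complex.exp (θ * Complex.I)) = Complex.exp (g θ * Complex.I)

/-- The radial mollified extension `F(f)` of a circle homeomorphism `f` with lift `g`:
`F(0) = 0`, `F(r e^{iθ}) = r e^{i (β_{1-r} * g)(θ)}` for `0 < r < 1`, and `F = f` on the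
circle. -/
def radExt (f : ℂ → ℂ) (g : ℝ → ℝ) (z : ℂ) : ℂ :=
  if ‖z‖ = 1 then f z
  else (‖z‖ : ℂ) *
    Complex.exp ((bumpConv (1 - ‖z‖) g (Complex.arg z) : ℝ) * Complex.I)

/-- Two continuous angle functions of the same circle-valued map differ by a constant multiple
of `2π`. -/
lemma exists_int_eq_add_of_exp_eq {a b : ℝ → ℝ} (ha : Continuous a) (hb : Continuous b)
    (h : ∀ θ, Complex.exp (a θ * Complex.I) = Complex.exp (b θ * Complex.I)) :
    ∃ k : ℤ, ∀ θ, a θ = b θ + k * (2 * Real.pi) := by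
  have hex : ∀ θ, ∃ n : ℤ, a θ = b θ + n * (2 * Real.pi) := fun θ ↦ by
    obtain ⟨n, hn⟩ := Complex.exp_eq_exp_iff_exists_int.1 (h θ)
    exact ⟨n, by simpa using congrArg Complex.im hn⟩
  choose n hn using hex
  have hcont : Continuous n := by
    rw [Int.isClosedEmbedding_coe_real.isEmbedding.continuous_iff]
    have hfun : ((↑) : ℤ → ℝ) ∘ n = fun θ ↦ (a θ - b θ) / (2 * Real.pi) := by
      funext θ
      simp only [Function.comp_apply]
      rw [hn θ, add_sub_cancel_left, mul_div_cancel_right₀ _ Real.two_pi_pos.ne']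
    rw [hfun]
    fun_prop
  exact ⟨n 0, fun θ ↦ by
    rw [hn θ, PreconnectedSpace.constant (inferInstance : PreconnectedSpace ℝ) hcont
      (x := θ) (y := 0)]⟩

lemma IsLift.unique {f : ℂ → ℂ} {g g' : ℝ → ℝ} (hg : IsLift f g) (hg' : IsLift f g') :
    g = g' := by
  obtain ⟨k, hk⟩ := exists_int_eq_add_of_exp_eq hg.1 hg'.1
    fun θ ↦ by rw [← hg.2.2, ← hg'.2.2]
  have hk0 := hk 0
  rw [hg.2.1, hg'.2.1, zero_add] at hk0
  funext θ
  rw [hk θ, ← hk0, add_zero]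

lemma IsLift.exists_int_add_two_pi {f : ℂ → ℂ} {g : ℝ → ℝ} (hg : IsLift f g) :
    ∃ k : ℤ, ∀ θ, g (θ + 2 * Real.pi) = g θ + k * (2 * Real.pi) := by
  refine exists_int_eq_add_of_exp_eq (a := fun θ ↦ g (θ + 2 * Real.pi))
    (hg.1.comp (by fun_prop)) hg.1 fun θ ↦ ?_
  rw [← hg.2.2, ← hg.2.2]
  congr 1
  exact Complex.exp_eq_exp_iff_exists_int.2 ⟨1, by push_cast; ring⟩

lemma conj_exp_ofReal_mul_I (θ : ℝ) :
    starRingEnd ℂ (Complex.exp (θ * Complex.I)) =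
      Complex.exp ((-θ : ℝ) * Complex.I) := by
  rw [← Complex.exp_conj]
  simp

lemma IsLift.comp_conj {f : ℂ → ℂ} {g : ℝ → ℝ} (hg : IsLift f g) :
    IsLift (fun z ↦ f (starRingEnd ℂ z)) (fun θ ↦ g (-θ)) :=
  ⟨hg.1.comp continuous_neg, by simpa using hg.2.1, fun θ ↦ by
    simp only [conj_exp_ofReal_mul_I]
    exact hg.2.2 (-θ)⟩

lemma bump_neg (ε x : ℝ) : bump ε (-x) = bump ε x := by
  simp [bump, neg_div]

lemma bumpConv_comp_neg (ε : ℝ) (g : ℝ → ℝ) (θ : ℝ) :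
    bumpConv ε (fun t ↦ g (-t)) θ = bumpConv ε g (-θ) := by
  unfold bumpConv
  rw [← integral_neg_eq_self]
  refine integral_congr_ae (.of_forall fun x ↦ ?_)
  simp only [bump_neg]
  congr 2
  ring

lemma expNegInvGlue_eq_exp {x : ℝ} (hx : 0 < x) : expNegInvGlue x = Real.exp (-1 / x) := by
  rw [expNegInvGlue, if_neg hx.not_ge, neg_div, one_div]

lemma continuous_expNegInvGlue_one_sub_sq :
    Continuous fun x : ℝ ↦ expNegInvGlue (1 - x ^ 2) :=
  (expNegInvGlue.contDiff (n := 0)).continuous.comp (by fun_prop)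

lemma hasCompactSupport_expNegInvGlue_one_sub_sq :
    HasCompactSupport fun x : ℝ ↦ expNegInvGlue (1 - x ^ 2) :=
  HasCompactSupport.intro (isCompact_Icc (a := (-1 : ℝ)) (b := 1)) fun x hx ↦
    expNegInvGlue.zero_of_nonpos <| by
      by_contra! h
      exact hx (abs_le.1 ((sq_le_one_iff_abs_le_one x).1 (by linarith)))

lemma bumpC_eq_integral : bumpC = ∫ x : ℝ, expNegInvGlue (1 - x ^ 2) := by
  rw [← intervalIntegral.integral_eq_integral_of_support_subset (a := -1) (b := 1)]
  · refine intervalIntegral.integral_congr_Ioo_of_le (by norm_num) fun x hx ↦ ?_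
    have hx' : x ^ 2 < 1 := (sq_lt_one_iff_abs_lt_one x).2 (abs_lt.2 hx)
    exact (expNegInvGlue_eq_exp (by linarith)).symm
  · intro x hx
    have hx' : x ^ 2 < 1 := by
      simpa using hx
    have := abs_lt.1 ((sq_lt_one_iff_abs_lt_one x).1 hx')
    exact ⟨this.1, this.2.le⟩

lemma bumpC_pos : 0 < bumpC := by
  rw [bumpC_eq_integral]
  exact continuous_expNegInvGlue_one_sub_sq.integral_pos_of_hasCompactSupport_nonneg_nonzero
    hasCompactSupport_expNegInvGlue_one_sub_sq (fun x ↦ expNegInvGlue.nonneg _)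
    (x := 0) (by simp)

lemma bump_eq {ε : ℝ} (hε : 0 < ε) (x : ℝ) :
    bump ε x = 1 / (bumpC * ε) * expNegInvGlue (1 - (x / ε) ^ 2) := by
  have hiff : |x| < ε ↔ (x / ε) ^ 2 < 1 := by
    rw [sq_lt_one_iff_abs_lt_one, abs_div, abs_of_pos hε, div_lt_one hε]
  unfold bump
  split_ifs with h
  · rw [expNegInvGlue_eq_exp (by linarith [hiff.1 h])]
  · rw [expNegInvGlue.zero_of_nonpos (by linarith [not_lt.1 (mt hiff.2 h)]), mul_zero]

lemma continuous_bump {ε : ℝ} (hε : 0 < ε) : Continuous (bump ε) := by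
  rw [funext (bump_eq hε)]
  exact continuous_const.mul
    (continuous_expNegInvGlue_one_sub_sq.comp (continuous_id.div_const ε))

lemma hasCompactSupport_bump (ε : ℝ) : HasCompactSupport (bump ε) :=
  HasCompactSupport.intro (isCompact_Icc (a := -ε) (b := ε)) fun _ hx ↦
    if_neg fun h ↦ hx (abs_le.1 h.le)

lemma integral_bump {ε : ℝ} (hε : 0 < ε) : ∫ x, bump ε x = 1 := by
  simp_rw [bump_eq hε]
  rw [integral_const_mul,
    Measure.integral_comp_div (fun x : ℝ ↦ expNegInvGlue (1 - x ^ 2)) ε,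
    ← bumpC_eq_integral, abs_of_pos hε, smul_eq_mul]
  have := bumpC_pos.ne'
  field_simp

lemma integrable_bump_mul {ε : ℝ} (hε : 0 < ε) {g : ℝ → ℝ} (hg : Continuous g) :
    Integrable fun x ↦ bump ε x * g x :=
  ((continuous_bump hε).mul hg).integrable_of_hasCompactSupport
    (hasCompactSupport_bump ε).mul_right

lemma bumpConv_add_of_forall {ε : ℝ} (hε : 0 < ε) {g : ℝ → ℝ} (hg : Continuous g) {T c : ℝ}
    (h : ∀ θ, g (θ + T) = g θ + c) (θ : ℝ) :
    bumpConv ε g (θ + T) = bumpConv ε g θ + c := by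
  unfold bumpConv
  have hx : ∀ x, bump ε x * g (θ + T - x) = bump ε x * g (θ - x) + bump ε x * c := fun x ↦ by
    rw [show θ + T - x = θ - x + T by ring, h, mul_add]
  simp_rw [hx]
  rw [integral_add (integrable_bump_mul hε (g := fun x ↦ g (θ - x)) (by fun_prop))
    (integrable_bump_mul hε continuous_const), integral_mul_const, integral_bump hε, one_mul]

/-- The value of the extension inside the disc does not depend on whether `conj z` is given the
angle `arg (conj z)` or `-arg z`; the two differ on the negative real axis. -/
lemma exp_bumpConv_arg_conj {f : ℂ → ℂ} {g : ℝ → ℝ} (hg : IsLift f g) {ε : ℝ} (hε : 0 < ε)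
    (z : ℂ) :
    Complex.exp ((bumpConv ε g (Complex.arg (starRingEnd ℂ z)) : ℝ) * Complex.I) =
      Complex.exp ((bumpConv ε g (-Complex.arg z) : ℝ) * Complex.I) := by
  rw [Complex.arg_conj]
  split_ifs with h
  · obtain ⟨k, hk⟩ := hg.exists_int_add_two_pi
    have hπ := bumpConv_add_of_forall hε hg.1 hk (-Real.pi)
    rw [show -Real.pi + 2 * Real.pi = Real.pi by ring] at hπ
    rw [h, hπ]
    exact Complex.exp_eq_exp_iff_exists_int.2 ⟨k, by push_cast; ring⟩
  · rfl

/-- Only the values of `h` on the circle matter for its extension. -/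
lemma radExt_eq_radExt_conj {f h : ℂ → ℂ} {g g' : ℝ → ℝ} (hg : IsLift f g)
    (hh : ∀ z : ℂ, ‖z‖ = 1 → h z = f (starRingEnd ℂ z)) (hg' : IsLift h g') {z : ℂ}
    (hz : z ∈ unitDisc) : radExt h g' z = radExt f g (starRingEnd ℂ z) := by
  have hlift : IsLift (fun w ↦ f (starRingEnd ℂ w)) g' :=
    ⟨hg'.1, hg'.2.1, fun θ ↦ by
      rw [← hg'.2.2, hh _ (Complex.norm_exp_ofReal_mul_I θ)]⟩
  have hnorm : ‖z‖ ≤ 1 := by simpa [unitDisc] using hz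
  unfold radExt
  rw [Complex.norm_conj]
  split_ifs with h1
  · exact hh z h1
  · rw [hlift.unique hg.comp_conj, bumpConv_comp_neg,
      exp_bumpConv_arg_conj hg (sub_pos.2 (lt_of_le_of_ne hnorm h1))]

/-- The radial mollified extension intertwines with complex conjugation:
`F(f ∘ conj) = F(f) ∘ conj` on the closed disc, and equivalently (since conjugation and
inversion agree on the circle) `F(f ∘ (z ↦ z⁻¹)) = F(f) ∘ conj` on the closed disc. -/
theorem radExt_conj (f : ℂ → ℂ) (hf : CircleHomeo f) (h1 : f 1 = 1)
    (g : ℝ → ℝ) (hg : IsLift f g) :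
    (∀ g' : ℝ → ℝ, IsLift (fun z => f (starRingEnd ℂ z)) g' →
      ∀ z ∈ unitDisc,
        radExt (fun w => f (starRingEnd ℂ w)) g' z = radExt f g (starRingEnd ℂ z)) ∧
    (∀ g' : ℝ → ℝ, IsLift (fun z => f z⁻¹) g' →
      ∀ z ∈ unitDisc,
        radExt (fun w => f w⁻¹) g' z = radExt f g (starRingEnd ℂ z)) := by
  exact ⟨fun g' hg' z hz ↦ radExt_eq_radExt_conj hg (fun _ _ ↦ rfl) hg' hz,
    fun g' hg' z hz ↦ radExt_eq_radExt_conj hg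
      (fun w hw ↦ by rw [Complex.inv_eq_conj hw]) hg' hz⟩
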